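/- Strictly monotone double Hurwitz numbers satisfy the symmetry H_g^>(μ; s) = H_g^>(μ; 2 - 2g + |μ| - ℓ(μ) - s), where H_g^>(μ;s) = (z_μ/|μ|!) ∑_{ν of length s} h_g^>(μ;ν). -/

import Mathlib

open scoped Classical

/-- The larger element moved by a transposition (as a natural number):
for `τ = (a,b)` with `a < b` this is `b`. -/
def maxMoved {d : ℕ} (τ : Equiv.Perm (Fin d)) : ℕ :=
  τ.support.sup (fun x => (x : ℕ))

/-- The strictly monotone double Hurwitz number `h_g^>(μ;ν)`: the number of tuples
`(α, τ_1, …, τ_r, β)` with `r = ℓ(μ) + ℓ(ν) + 2g - 2`, where `α, β` are permutations of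
`{1,…,d}` of cycle types `μ, ν` with `α τ_1 ⋯ τ_r = β`, the `τ_j` are transpositions whose
larger elements are strictly increasing, and `⟨α, τ_1, …, τ_r⟩` acts transitively. -/
noncomputable def hurwitzStrict (d g : ℕ) (μ ν : Nat.Partition d) : ℕ :=
  Nat.card {t : Equiv.Perm (Fin d) × List (Equiv.Perm (Fin d)) × Equiv.Perm (Fin d) //
    (Equiv.Perm.partition t.1).parts = μ.parts ∧
    (Equiv.Perm.partition t.2.2).parts = ν.parts ∧
    t.2.1.length + 2 = μ.parts.card + ν.parts.card + 2 * g ∧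
    (∀ τ ∈ t.2.1, τ.IsSwap) ∧
    t.1 * t.2.1.prod = t.2.2 ∧
    (∀ x y : Fin d, ∃ p ∈ Subgroup.closure (insert t.1 {σ | σ ∈ t.2.1}), p x = y) ∧
    t.2.1.Pairwise (fun τ σ => maxMoved τ < maxMoved σ)}

/-- `z_μ = ∏_i i^{m_i} m_i!` where `m_i` is the multiplicity of `i` in `μ`. -/
def zPart {d : ℕ} (μ : Nat.Partition d) : ℕ :=
  ∏ i ∈ Finset.range (d + 1), i ^ (μ.parts.count i) * (μ.parts.count i).factorial

/-- The weighted strictly monotone double Hurwitz numbers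
`H_g^>(μ;s) = (z_μ/|μ|!) ∑_{ν of length s} h_g^>(μ;ν)`. -/
noncomputable def HStrict (d g : ℕ) (μ : Nat.Partition d) (s : ℕ) : ℚ :=
  ((zPart μ : ℚ) / (d.factorial : ℚ)) *
    ∑ ν ∈ Finset.univ.filter (fun ν : Nat.Partition d => ν.parts.card = s),
      (hurwitzStrict d g μ ν : ℚ)

namespace HSym

open Equiv Equiv.Perm

theorem ncyc_swap {d : ℕ} (σ : Perm (Fin d)) (b : Fin d) (hb : σ b ≠ b) :
    (Equiv.Perm.partition (swap b (σ b) * σ)).parts.card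
      = (Equiv.Perm.partition σ).parts.card + 1 := by
  have hmem : σ.cycleOf b ∈ σ.cycleFactorsFinset := by
    rw [cycleOf_mem_cycleFactorsFinset_iff]; simpa using hb
  have hcyc : (σ.cycleOf b).IsCycle := (mem_cycleFactorsFinset_iff.1 hmem).1
  have hdis := (disjoint_mul_inv_of_mem_cycleFactorsFinset hmem).symm
  have hcb : σ.cycleOf b b = σ b := cycleOf_apply_self σ b
  have hcb2 : σ.cycleOf b (σ b) = σ (σ b) := by
    have : SameCycle σ b (σ b) := ⟨1, by simp⟩
    exact this.cycleOf_apply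
  have hσ : σ = σ.cycleOf b * (σ * (σ.cycleOf b)⁻¹) := by
    rw [hdis.commute.eq]; simp
  generalize σ.cycleOf b = c at *
  generalize σ * c⁻¹ = ρ at *
  have hsup := hdis.card_support_mul
  have hle : (c * ρ).support.card ≤ Fintype.card (Fin d) := Finset.card_le_univ _
  have hct := hdis.cycleType_mul
  have hc1 := card_cycleType_eq_one.2 hcyc
  by_cases h2 : σ (σ b) = b
  · have hcs : c = swap b (c b) :=
      hcyc.eq_swap_of_apply_apply_eq_self (by rwa [hcb]) (by rw [hcb, hcb2, h2])
    have hs2 : c.support.card = 2 := by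
      rw [hcs, hcb]; exact card_support_swap hb.symm
    have hprod : swap b (σ b) * σ = ρ := by
      rw [← hcb, ← hcs]
      conv_lhs => rw [hσ, hcs]
      rw [← mul_assoc]; simp
    rw [hprod]
    conv_rhs => rw [hσ]
    simp only [parts_partition, Multiset.card_add, Multiset.card_replicate, hct]
    omega
  · have hcc : c (c b) ≠ b := by rw [hcb, hcb2]; exact h2
    have hcyc' := hcyc.swap_mul (x := b) (by rwa [hcb]) hcc
    have hs' := support_swap_mul_eq c b hcc
    have hbs : b ∈ c.support := by rw [mem_support, hcb]; exact hb
    have hcard : (swap b (c b) * c).support.card + 1 = c.support.card := by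
      rw [hs', Finset.sdiff_singleton_eq_erase]
      exact Finset.card_erase_add_one hbs
    have hprod : swap b (σ b) * σ = (swap b (c b) * c) * ρ := by
      rw [hcb, mul_assoc, ← hσ]
    have hdis' : Disjoint (swap b (c b) * c) ρ := by
      rw [disjoint_iff_disjoint_support] at hdis ⊢
      exact Finset.disjoint_of_subset_left (by rw [hs']; exact Finset.sdiff_subset) hdis
    have hc1' := card_cycleType_eq_one.2 hcyc'
    have hsup' := hdis'.card_support_mul
    have hct' := hdis'.cycleType_mul
    rw [hprod]
    conv_rhs => rw [hσ]
    simp only [parts_partition, Multiset.card_add, Multiset.card_replicate, hct, hct']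
    omega

theorem ncyc_swap' {d : ℕ} (σ : Perm (Fin d)) (a b : Fin d) (hab : a ≠ b) (hb : σ b = b) :
    (Equiv.Perm.partition σ).parts.card
      = (Equiv.Perm.partition (σ * swap a b)).parts.card + 1 := by
  have h := ncyc_swap (σ * swap a b) b (by
    simp only [mul_apply, swap_apply_right]
    intro h; exact hab (σ.injective (h.trans hb.symm)))
  rw [← h]
  congr 2
  have : swap b ((σ * swap a b) b) = σ * swap a b * σ⁻¹ := by
    rw [← Equiv.swap_apply_apply σ a b]
    simp [hb, swap_comm]
  rw [this]; congr 1; rw [mul_assoc, mul_assoc]; simp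

/-- Admissible lists. -/
def Adm {d : ℕ} (l : List (Perm (Fin d))) : Prop :=
  (∀ τ ∈ l, τ.IsSwap) ∧ l.Pairwise (fun τ σ => maxMoved τ < maxMoved σ)

theorem fix_of_max {d : ℕ} (τ : Perm (Fin d)) (x : Fin d) (h : maxMoved τ < x) : τ x = x := by
  by_contra hx
  have : (x : ℕ) ≤ maxMoved τ :=
    Finset.le_sup (f := fun x : Fin d => (x : ℕ)) (mem_support.2 hx)
  omega

theorem max_swap {d : ℕ} (a b : Fin d) (h : a < b) : maxMoved (swap a b) = b := by
  unfold maxMoved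
  rw [support_swap h.ne]
  have : (a : ℕ) ≤ b := h.le
  simpa [Finset.sup_insert] using this

theorem exists_swap {d : ℕ} (τ : Perm (Fin d)) (h : τ.IsSwap) :
    ∃ a b : Fin d, a < b ∧ τ = swap a b := by
  obtain ⟨x, y, hxy, rfl⟩ := h
  rcases lt_or_gt_of_ne hxy with h | h
  · exact ⟨x, y, h, rfl⟩
  · exact ⟨y, x, h, swap_comm _ _⟩

theorem prod_fix {d : ℕ} (l : List (Perm (Fin d))) (x : Fin d)
    (h : ∀ τ ∈ l, τ x = x) : l.prod x = x := by
  induction l with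
  | nil => rfl
  | cons τ l ih =>
    rw [List.prod_cons, mul_apply, ih (fun τ h' => h τ (by simp [h'])), h τ (by simp)]

theorem adm_concat {d : ℕ} (l : List (Perm (Fin d))) (τ : Perm (Fin d)) :
    Adm (l ++ [τ]) ↔ Adm l ∧ τ.IsSwap ∧ ∀ σ ∈ l, maxMoved σ < maxMoved τ := by
  unfold Adm
  rw [List.pairwise_append]
  simp only [List.mem_append, List.mem_singleton]
  constructor
  · rintro ⟨h1, h2, -, h3⟩
    exact ⟨⟨fun τ h => h1 τ (Or.inl h), h2⟩, h1 _ (Or.inr rfl), fun σ hs => h3 σ hs _ rfl⟩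
  · rintro ⟨⟨h1, h2⟩, h3, h4⟩
    refine ⟨?_, h2, by simp, ?_⟩
    · rintro σ (h | rfl)
      · exact h1 _ h
      · exact h3
    · rintro σ hs _ rfl; exact h4 σ hs

/-- Structure of the last step. -/
theorem adm_last {d : ℕ} (l : List (Perm (Fin d))) (τ : Perm (Fin d)) (h : Adm (l ++ [τ])) :
    ∃ a b : Fin d, a < b ∧ τ = swap a b ∧ l.prod b = b ∧ (l ++ [τ]).prod a = b ∧
      (l ++ [τ]).prod b ≠ b ∧ ∀ x, b < x → (l ++ [τ]).prod x = x := by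
  rw [adm_concat] at h
  obtain ⟨h1, h2, h3⟩ := h
  obtain ⟨a, b, hab, rfl⟩ := exists_swap τ h2
  rw [max_swap a b hab] at h3
  have hb : l.prod b = b := prod_fix _ _ fun τ ht => fix_of_max τ b (h3 τ ht)
  refine ⟨a, b, hab, rfl, hb, by simp [hb], ?_, ?_⟩
  · simp only [List.prod_append, List.prod_singleton, mul_apply, swap_apply_right]
    intro h; exact hab.ne (l.prod.injective (h.trans hb.symm))
  · intro x hx
    have hlx : l.prod x = x := prod_fix _ _ fun τ ht => fix_of_max τ x
      ((h3 τ ht).trans hx)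
    simp only [List.prod_append, List.prod_singleton, mul_apply]
    rw [swap_apply_of_ne_of_ne (hab.trans hx).ne' hx.ne', hlx]

theorem adm_unique {d : ℕ} (l : List (Perm (Fin d))) : ∀ l' : List (Perm (Fin d)),
    Adm l → Adm l' → l.prod = l'.prod → l = l' := by
  induction l using List.reverseRecOn with
  | nil =>
    intro l' _ h' he
    induction l' using List.reverseRecOn with
    | nil => rfl
    | append_singleton l' τ _ =>
      obtain ⟨a, b, hab, -, -, -, hne, -⟩ := adm_last l' τ h'
      rw [← he] at hne; simp at hne
  | append_singleton l τ ih =>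
    intro l' h h' he
    obtain ⟨a, b, hab, rfl, hb, ha, hne, hx⟩ := adm_last l τ h
    induction l' using List.reverseRecOn with
    | nil => rw [he] at hne; simp at hne
    | append_singleton l' τ' _ =>
      obtain ⟨a', b', hab', rfl, hb', ha', hne', hx'⟩ := adm_last l' τ' h'
      have hbb : b = b' := by
        rcases lt_trichotomy b b' with hlt | heq | hlt
        · exact absurd (hx _ hlt) (by rw [he]; exact hne')
        · exact heq
        · exact absurd (hx' _ hlt) (by rw [← he]; exact hne)
      subst hbb
      have haa : a = a' := by
        apply (l' ++ [swap a' b]).prod.injective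
        rw [ha', ← he, ha]
      subst haa
      rw [ih l' ((adm_concat _ _).1 h).1 ((adm_concat _ _).1 h').1 ?_]
      simpa using he

theorem adm_exists_aux {d : ℕ} (n : ℕ) : ∀ σ : Perm (Fin d), (∀ x : Fin d, n ≤ x → σ x = x) →
    ∃ l, Adm l ∧ l.prod = σ ∧ ∀ τ ∈ l, maxMoved τ < n := by
  induction n with
  | zero =>
    intro σ h
    refine ⟨[], by simp [Adm], ?_, by simp⟩
    ext x; simp [h x]
  | succ n ih =>
    intro σ h
    by_cases hn : ∀ x : Fin d, n ≤ x → σ x = x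
    · obtain ⟨l, h1, h2, h3⟩ := ih σ hn
      exact ⟨l, h1, h2, fun τ ht => (h3 τ ht).trans (Nat.lt_succ_self n)⟩
    · push Not at hn
      obtain ⟨b, hnb, hb⟩ := hn
      have hbn : (b : ℕ) = n := by
        by_contra hne
        exact hb (h b (by omega))
      obtain ⟨a, ha⟩ := σ.surjective b
      have hab : a < b := by
        rcases lt_trichotomy a b with hlt | heq | hlt
        · exact hlt
        · subst heq; exact absurd ha hb
        · have : (b : ℕ) < a := hlt
          have := h a (by omega)
          rw [ha] at this; exact absurd this hlt.ne
      obtain ⟨l, h1, h2, h3⟩ := ih (σ * swap a b) (by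
        intro x hx
        by_cases hxb : x = b
        · subst hxb; simp [ha]
        · have hxb' : (x : ℕ) ≠ b := fun h => hxb (Fin.ext h)
          have hxa : x ≠ a := by
            rintro rfl
            have : (x : ℕ) < b := hab
            omega
          rw [mul_apply, swap_apply_of_ne_of_ne hxa hxb, h x (by omega)])
      refine ⟨l ++ [swap a b], ?_, ?_, ?_⟩
      · rw [adm_concat]
        refine ⟨h1, ⟨a, b, hab.ne, rfl⟩, ?_⟩
        rw [max_swap a b hab, hbn]; exact h3
      · simp [h2, mul_assoc]
      · intro τ ht
        rcases List.mem_append.1 ht with ht | ht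
        · exact (h3 τ ht).trans (Nat.lt_succ_self n)
        · rw [List.mem_singleton.1 ht, max_swap a b hab]; omega

theorem adm_exists {d : ℕ} (σ : Perm (Fin d)) : ∃ l, Adm l ∧ l.prod = σ := by
  obtain ⟨l, h1, h2, -⟩ := adm_exists_aux d σ (fun x hx => absurd x.2 (by omega))
  exact ⟨l, h1, h2⟩

theorem adm_length {d : ℕ} (l : List (Perm (Fin d))) : Adm l →
    l.length + (Equiv.Perm.partition l.prod).parts.card = d := by
  induction l using List.reverseRecOn with
  | nil => intro _; simp [parts_partition]
  | append_singleton l τ ih =>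
    intro h
    obtain ⟨a, b, hab, rfl, hb, -⟩ := adm_last l τ h
    have h1 := ih ((adm_concat _ _).1 h).1
    have h2 := ncyc_swap' l.prod a b hab.ne hb
    simp only [List.length_append, List.length_singleton, List.prod_append, List.prod_singleton]
    omega

theorem same_step {d : ℕ} (σ : Perm (Fin d)) (a b : Fin d) (hb : σ b = b) (x : Fin d) :
    SameCycle (σ * swap a b) x (σ x) := by
  by_cases hxb : x = b
  · subst hxb; rw [hb]
  by_cases hxa : x = a
  · subst hxa
    refine ⟨2, ?_⟩
    rw [zpow_ofNat, pow_two]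
    simp [hb]
  · refine ⟨1, ?_⟩
    simp [swap_apply_of_ne_of_ne hxa hxb]

theorem same_mono {d : ℕ} (σ ρ : Perm (Fin d)) (h : ∀ x, SameCycle ρ x (σ x)) (x y : Fin d)
    (hxy : SameCycle σ x y) : SameCycle ρ x y := by
  obtain ⟨n, -, -, rfl⟩ := hxy.exists_pow_eq''
  clear hxy
  induction n with
  | zero => exact SameCycle.refl _ _
  | succ n ih =>
    rw [pow_succ']
    exact ih.trans (h _)

theorem adm_same {d : ℕ} (l : List (Perm (Fin d))) : Adm l →
    ∀ τ ∈ l, ∀ x, SameCycle l.prod x (τ x) := by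
  induction l using List.reverseRecOn with
  | nil => simp
  | append_singleton l τ ih =>
    intro h
    obtain ⟨a, b, hab, rfl, hb, ha, -⟩ := adm_last l τ h
    have h1 := ih ((adm_concat _ _).1 h).1
    intro τ' ht x
    rcases List.mem_append.1 ht with ht | ht
    · rw [List.prod_append, List.prod_singleton]
      exact same_mono _ _ (same_step l.prod a b hb) _ _ (h1 τ' ht x)
    · rw [List.mem_singleton.1 ht]
      have hs : SameCycle (l ++ [swap a b]).prod a b := ⟨1, by simpa using ha⟩
      by_cases hxa : x = a
      · subst hxa; simpa using hs
      by_cases hxb : x = b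
      · subst hxb; simpa using hs.symm
      rw [swap_apply_of_ne_of_ne hxa hxb]

/-- Transitivity of the subgroup generated by a set. -/
def Trans {d : ℕ} (S : Set (Perm (Fin d))) : Prop :=
  ∀ x y : Fin d, ∃ p ∈ Subgroup.closure S, p x = y

theorem trans_of {d : ℕ} (S T : Set (Perm (Fin d)))
    (h : ∀ τ ∈ S, ∀ x, ∃ p ∈ Subgroup.closure T, p x = τ x) (hS : Trans S) : Trans T := by
  intro x y
  obtain ⟨p, hp, rfl⟩ := hS x y
  clear hS
  induction hp using Subgroup.closure_induction generalizing x with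
  | mem τ ht => exact h τ ht x
  | one => exact ⟨1, one_mem _, rfl⟩
  | mul p q _ _ ihp ihq =>
    obtain ⟨u, hu, hux⟩ := ihq x
    obtain ⟨v, hv, hvx⟩ := ihp (q x)
    exact ⟨v * u, mul_mem hv hu, by rw [mul_apply, hux, hvx, mul_apply]⟩
  | inv p _ ih =>
    obtain ⟨u, hu, hux⟩ := ih (p⁻¹ x)
    refine ⟨u⁻¹, inv_mem hu, ?_⟩
    rw [inv_eq_iff_eq, hux]; simp

theorem trans_iff {d : ℕ} (α : Perm (Fin d)) (l : List (Perm (Fin d))) (h : Adm l) :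
    Trans (insert α {σ | σ ∈ l}) ↔ Trans {α, l.prod} := by
  constructor
  · apply trans_of
    rintro τ (rfl | ht) x
    · exact ⟨τ, Subgroup.subset_closure (by simp), rfl⟩
    · obtain ⟨n, hn⟩ := adm_same l h τ ht x
      exact ⟨_, zpow_mem (Subgroup.subset_closure (by simp)) n, hn⟩
  · apply trans_of
    rintro τ (rfl | rfl) x
    · exact ⟨τ, Subgroup.subset_closure (by simp), rfl⟩
    · exact ⟨_, list_prod_mem fun σ hs => Subgroup.subset_closure (Or.inr hs), rfl⟩

theorem trans_swap {d : ℕ} (α σ : Perm (Fin d)) (h : Trans {α, σ}) : Trans {α⁻¹, α * σ} := by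
  have h1 : α ∈ Subgroup.closure {α⁻¹, α * σ} := by
    rw [← inv_mem_iff]; exact Subgroup.subset_closure (by simp)
  have h2 : σ ∈ Subgroup.closure {α⁻¹, α * σ} := by
    rw [← Subgroup.mul_mem_cancel_left _ h1]; exact Subgroup.subset_closure (by simp)
  revert h
  apply trans_of
  rintro τ (rfl | rfl) x
  · exact ⟨_, h1, rfl⟩
  · exact ⟨_, h2, rfl⟩

/-- The pairs counted. -/
noncomputable def pairs {d : ℕ} (μ : Nat.Partition d) (s s' : ℕ) :
    Finset (Perm (Fin d) × Perm (Fin d)) :=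
  Finset.univ.filter fun t => (Equiv.Perm.partition t.1).parts = μ.parts ∧
    (Equiv.Perm.partition (t.1 * t.2)).parts.card = s ∧
    (Equiv.Perm.partition t.2).parts.card = s' ∧ Trans {t.1, t.2}

theorem pairs_le {d : ℕ} (μ : Nat.Partition d) (s s' : ℕ) :
    (pairs μ s s').card ≤ (pairs μ s' s).card := by
  apply Finset.card_le_card_of_injOn (fun t => (t.1⁻¹, t.1 * t.2))
  · intro t ht
    simp only [pairs, Finset.coe_filter, Finset.mem_univ, true_and, Set.mem_ofPred_eq] at ht ⊢
    obtain ⟨h1, h2, h3, h4⟩ := ht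
    refine ⟨?_, ?_, h2, trans_swap _ _ h4⟩
    · rw [← h1]; simp [parts_partition]
    · simpa using h3
  · rintro ⟨a, b⟩ - ⟨a', b'⟩ - h
    simp only [Prod.mk.injEq, inv_inj] at h
    obtain ⟨rfl, h⟩ := h
    simpa using h

/-- The cycle type as a partition of `d`. -/
def toP {d : ℕ} (β : Perm (Fin d)) : Nat.Partition d :=
  ⟨(Equiv.Perm.partition β).parts, fun h => (Equiv.Perm.partition β).parts_pos h,
    by rw [(Equiv.Perm.partition β).parts_sum, Fintype.card_fin]⟩

theorem hurwitz_eq (d g : ℕ) (μ ν : Nat.Partition d) (s s' : ℕ)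
    (h : s + s' + 2 * g + μ.parts.card = d + 2) (hν : ν.parts.card = s) :
    hurwitzStrict d g μ ν = ((pairs μ s s').filter fun t => toP (t.1 * t.2) = ν).card := by
  unfold hurwitzStrict
  rw [← Nat.card_eq_finsetCard]
  refine Nat.card_congr (Equiv.ofBijective
    (fun t => ⟨(t.1.1, t.1.2.1.prod), ?_⟩) ⟨?_, ?_⟩)
  · obtain ⟨⟨α, l, β⟩, h1, h2, h3, h4, h5, h6, h7⟩ := t
    dsimp only at *
    have hl := adm_length l ⟨h4, h7⟩
    simp only [pairs, Finset.mem_filter, Finset.mem_univ, true_and]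
    refine ⟨⟨h1, ?_, ?_, (trans_iff α l ⟨h4, h7⟩).1 h6⟩, ?_⟩
    · rw [h5, h2, hν]
    · change l.length + 2 = _ at h3
      omega
    · ext1; rw [h5]; exact h2
  · rintro ⟨⟨α, l, β⟩, h1, h2, h3, h4, h5, h6, h7⟩ ⟨⟨α', l', β'⟩, h1', h2', h3', h4', h5', h6', h7'⟩ he
    simp only [Subtype.mk.injEq, Prod.mk.injEq] at *
    obtain ⟨rfl, he⟩ := he
    have := adm_unique l l' ⟨h4, h7⟩ ⟨h4', h7'⟩ he
    subst this
    exact ⟨rfl, rfl, h5.symm.trans h5'⟩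
  · rintro ⟨⟨α, σ⟩, ht⟩
    simp only [pairs, Finset.mem_filter, Finset.mem_univ, true_and] at ht
    obtain ⟨⟨h1, h2, h3, h4⟩, h5⟩ := ht
    obtain ⟨l, hl, rfl⟩ := adm_exists σ
    have hlen := adm_length l hl
    refine ⟨⟨(α, l, α * l.prod), h1, ?_, ?_, hl.1, rfl, (trans_iff α l hl).2 h4, hl.2⟩, rfl⟩
    · rw [← h5]; rfl
    · dsimp only; omega

end HSym

/-- The symmetry `H_g^>(μ; s) = H_g^>(μ; 2 - 2g + |μ| - ℓ(μ) - s)`, stated for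
`s + s' = 2 - 2g + d - ℓ(μ)`, i.e. `s + s' + 2g + ℓ(μ) = d + 2`. -/
theorem HStrict_symmetry (d g : ℕ) (μ : Nat.Partition d) (s s' : ℕ)
    (h : s + s' + 2 * g + μ.parts.card = d + 2) :
    HStrict d g μ s = HStrict d g μ s' := by
  have key : ∀ s s' : ℕ, s + s' + 2 * g + μ.parts.card = d + 2 →
      ∑ ν ∈ Finset.univ.filter (fun ν : Nat.Partition d => ν.parts.card = s),
      (hurwitzStrict d g μ ν : ℚ) = ((HSym.pairs μ s s').card : ℚ) := by
    intro s s' h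
    rw [Finset.card_eq_sum_card_fiberwise (f := fun t => HSym.toP (t.1 * t.2))
      (t := Finset.univ.filter (fun ν : Nat.Partition d => ν.parts.card = s))]
    · push_cast
      apply Finset.sum_congr rfl
      intro ν hν
      rw [HSym.hurwitz_eq d g μ ν s s' h (by simpa using hν)]
    · intro t ht
      simp only [HSym.pairs, Finset.coe_filter, Finset.mem_univ, true_and, Set.mem_ofPred_eq] at ht ⊢
      exact ht.2.1
  unfold HStrict
  rw [key s s' h, key s' s (by omega), le_antisymm (HSym.pairs_le μ s s') (HSym.pairs_le μ s' s)]
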